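/- arXiv:1403.1756 — 2 statements merged into one kernel-verified Lean document; each statement's English description precedes it below -/
import Mathlib

section
/- Let a < x0 < b be real numbers and let Φ be the standard normal distribution function. Suppose u, v : (0,∞) → ℝ are continuous and locally integrable, and satisfy, for every t > 0, both equations: 1 − Φ((b − x0)/√t) = ∫_0^t [1 − Φ((b−a)/√(t−τ))] u(τ) dτ + (1/2) ∫_0^t v(τ) dτ, and Φ((a − x0)/√t) = (1/2) ∫_0^t u(τ) dτ + ∫_0^t Φ((a−b)/√(t−τ)) v(τ) dτ. Then u(t) = Σ_{k ∈ ℤ} (x0 − a + 2k(b−a))/√(2π t³) · exp(−(x0 − a + 2k(b−a))²/(2t)) and v(t) = Σ_{k ∈ ℤ} (b − x0 + 2k(b−a))/√(2π t³) · exp(−(b − x0 + 2k(b−a))²/(2t)) for all t > 0. -/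
open MeasureTheory Set

/-- The standard normal cumulative distribution function. -/
noncomputable def stdNormalCDF (x : ℝ) : ℝ :=
  ∫ u in Set.Iic x, Real.exp (-u ^ 2 / 2) / Real.sqrt (2 * Real.pi)

open Filter Topology

section NormalCDF

lemma integrable_stdNormalDensity :
    Integrable (fun u : ℝ => Real.exp (-u ^ 2 / 2) / Real.sqrt (2 * Real.pi)) := by
  have h := (integrable_exp_neg_mul_sq (b := 1 / 2) (by norm_num)).div_const
    (Real.sqrt (2 * Real.pi))
  refine h.congr (ae_of_all _ fun x => ?_)
  ring_nf

lemma integral_stdNormalDensity :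
    ∫ u : ℝ, Real.exp (-u ^ 2 / 2) / Real.sqrt (2 * Real.pi) = 1 := by
  have h := integral_gaussian (1 / 2)
  have e : ∀ u : ℝ, Real.exp (-u ^ 2 / 2) = Real.exp (-(1 / 2) * u ^ 2) := fun u => by ring_nf
  simp_rw [e]
  rw [integral_div, h, show Real.pi / (1 / 2) = 2 * Real.pi by ring]
  exact div_self (by positivity)

lemma stdNormalCDF_neg (x : ℝ) : stdNormalCDF (-x) = 1 - stdNormalCDF x := by
  have h1 := integral_comp_neg_Iic (-x)
    (fun u : ℝ => Real.exp (-u ^ 2 / 2) / Real.sqrt (2 * Real.pi))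
  have h2 := integral_add_compl (measurableSet_Iic (a := x)) integrable_stdNormalDensity
  simp only [even_two, Even.neg_pow, neg_neg, compl_Iic, integral_stdNormalDensity] at h1 h2
  unfold stdNormalCDF
  linarith

lemma tendsto_stdNormalCDF_atTop : Tendsto stdNormalCDF atTop (𝓝 1) := by
  have h := (aecover_Iic (μ := volume) (tendsto_id (α := ℝ) (x := atTop)))
    |>.integral_tendsto_of_countably_generated integrable_stdNormalDensity
  rwa [integral_stdNormalDensity] at h

lemma tendsto_stdNormalCDF_atBot : Tendsto stdNormalCDF atBot (𝓝 0) := by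
  have h := (tendsto_stdNormalCDF_atTop.comp tendsto_neg_atBot_atTop).const_sub 1
  simpa [Function.comp_def, stdNormalCDF_neg] using h

lemma hasDerivAt_stdNormalCDF (x : ℝ) :
    HasDerivAt stdNormalCDF (Real.exp (-x ^ 2 / 2) / Real.sqrt (2 * Real.pi)) x := by
  have hc : Continuous (fun u : ℝ => Real.exp (-u ^ 2 / 2) / Real.sqrt (2 * Real.pi)) := by
    fun_prop
  have h := (intervalIntegral.integral_hasDerivAt_right (hc.intervalIntegrable 0 x)
    hc.aestronglyMeasurable.stronglyMeasurableAtFilter hc.continuousAt).const_add (stdNormalCDF 0)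
  refine h.congr_of_eventuallyEq (Eventually.of_forall fun y => ?_)
  have := intervalIntegral.integral_Iic_sub_Iic (a := 0) (b := y)
    integrable_stdNormalDensity.integrableOn integrable_stdNormalDensity.integrableOn
  simp only [← this, stdNormalCDF]
  ring

end NormalCDF

/-- The first-hitting density of a level at distance `c` by a standard Brownian motion, extended
by zero to nonpositive times (and oddly in `c`). -/
noncomputable def hittingDensity (c t : ℝ) : ℝ :=
  c / Real.sqrt (2 * Real.pi * t ^ 3) * Real.exp (-c ^ 2 / (2 * t))

section HittingDensity

lemma hittingDensity_of_nonpos (c : ℝ) {t : ℝ} (ht : t ≤ 0) : hittingDensity c t = 0 := by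
  have : 2 * Real.pi * t ^ 3 ≤ 0 := by
    have : t ^ 3 ≤ 0 := by nlinarith [sq_nonneg t, mul_nonneg (sq_nonneg t) (neg_nonneg.2 ht)]
    exact mul_nonpos_of_nonneg_of_nonpos (by positivity) this
  simp [hittingDensity, Real.sqrt_eq_zero_of_nonpos this]

lemma hittingDensity_neg (c t : ℝ) : hittingDensity (-c) t = -hittingDensity c t := by
  simp [hittingDensity, neg_div]

lemma hittingDensity_of_pos (c : ℝ) {t : ℝ} (ht : 0 < t) :
    hittingDensity c t =
      c / (Real.sqrt (2 * Real.pi) * (t * Real.sqrt t)) * Real.exp (-c ^ 2 / (2 * t)) := by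
  rw [hittingDensity, Real.sqrt_mul (by positivity), show t ^ 3 = t ^ 2 * t by ring,
    Real.sqrt_mul (by positivity) t, Real.sqrt_sq ht.le]

lemma hittingDensity_nonneg {c : ℝ} (hc : 0 < c) (t : ℝ) : 0 ≤ hittingDensity c t := by
  unfold hittingDensity; positivity

lemma hittingDensity_le {c : ℝ} (hc : 0 < c) (t : ℝ) :
    hittingDensity c t ≤ 8 * Real.sqrt t / c ^ 3 := by
  rcases le_or_gt t 0 with ht | ht
  · rw [hittingDensity_of_nonpos c ht]; positivity
  rw [hittingDensity_of_pos c ht]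
  have hexp : Real.exp (-c ^ 2 / (2 * t)) ≤ 8 * t ^ 2 / c ^ 4 := by
    have h := Real.quadratic_le_exp_of_nonneg (x := c ^ 2 / (2 * t)) (by positivity)
    rw [neg_div, Real.exp_neg]
    have h1 : c ^ 4 / (8 * t ^ 2) ≤ Real.exp (c ^ 2 / (2 * t)) := by
      have h2 : (c ^ 2 / (2 * t)) ^ 2 / 2 = c ^ 4 / (8 * t ^ 2) := by field_simp; ring
      have h3 : 0 ≤ c ^ 2 / (2 * t) := by positivity
      linarith
    have := inv_anti₀ (by positivity) h1
    rwa [inv_div] at this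
  have hpi : 1 ≤ Real.sqrt (2 * Real.pi) := by
    rw [Real.one_le_sqrt]; linarith [Real.pi_gt_three]
  have hs : Real.sqrt t * Real.sqrt t = t := Real.mul_self_sqrt ht.le
  have hs0 : 0 < Real.sqrt t := Real.sqrt_pos.2 ht
  calc _ ≤ c / (1 * (t * Real.sqrt t)) * (8 * t ^ 2 / c ^ 4) := by gcongr
    _ = 8 * (Real.sqrt t * Real.sqrt t) / (Real.sqrt t * c ^ 3) := by rw [hs]; field_simp
    _ = _ := by field_simp

lemma norm_hittingDensity_le {c T t : ℝ} (hc : 0 < c) (ht : t ≤ T) :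
    ‖hittingDensity c t‖ ≤ 8 * Real.sqrt T / c ^ 3 := by
  rw [Real.norm_of_nonneg (hittingDensity_nonneg hc t)]
  exact (hittingDensity_le hc t).trans (by gcongr)

lemma continuous_hittingDensity {c : ℝ} (hc : 0 < c) : Continuous (hittingDensity c) := by
  refine continuous_iff_continuousAt.2 fun t => ?_
  rcases lt_trichotomy t 0 with ht | rfl | ht
  · refine (continuousAt_const (y := (0 : ℝ))).congr ?_
    filter_upwards [gt_mem_nhds ht] with s hs using (hittingDensity_of_nonpos c hs.le).symm
  · rw [ContinuousAt, hittingDensity_of_nonpos c le_rfl]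
    refine squeeze_zero (hittingDensity_nonneg hc) (hittingDensity_le hc) ?_
    have : Continuous fun t : ℝ => 8 * Real.sqrt t / c ^ 3 := by fun_prop
    simpa using this.tendsto 0
  · have h1 : Real.sqrt (2 * Real.pi * t ^ 3) ≠ 0 := by positivity
    have h2 : 2 * t ≠ 0 := by positivity
    unfold hittingDensity
    fun_prop (disch := assumption)

lemma integral_hittingDensity {c t : ℝ} (hc : 0 < c) (ht : 0 < t) :
    ∫ s in (0 : ℝ)..t, hittingDensity c s = 2 * (1 - stdNormalCDF (c / Real.sqrt t)) := by
  have hcont : ContinuousAt (fun s : ℝ => 2 * (1 - stdNormalCDF (c / Real.sqrt s))) t := by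
    have h1 : Real.sqrt t ≠ 0 := by positivity
    have h2 : ContinuousAt (fun s : ℝ => c / Real.sqrt s) t := by fun_prop (disch := assumption)
    exact ((ContinuousAt.comp (f := fun s : ℝ => c / Real.sqrt s)
      (hasDerivAt_stdNormalCDF _).continuousAt h2).const_sub 1).const_mul 2
  have hlim : Tendsto (fun s : ℝ => 2 * (1 - stdNormalCDF (c / Real.sqrt s))) (𝓝[>] 0)
      (𝓝 0) := by
    have h1 : Tendsto Real.sqrt (𝓝[>] 0) (𝓝[>] 0) := by
      refine tendsto_nhdsWithin_iff.2 ⟨?_, ?_⟩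
      · simpa using (Real.continuous_sqrt.tendsto 0).mono_left nhdsWithin_le_nhds
      · filter_upwards [self_mem_nhdsWithin] with s hs using Real.sqrt_pos.2 hs
    have h2 : Tendsto (fun s : ℝ => c / Real.sqrt s) (𝓝[>] 0) atTop := by
      simpa [div_eq_mul_inv] using (h1.inv_tendsto_nhdsGT_zero).const_mul_atTop hc
    simpa using ((tendsto_stdNormalCDF_atTop.comp h2).const_sub 1).const_mul 2
  rw [intervalIntegral.integral_eq_sub_of_hasDerivAt_of_tendsto ht ?_
    ((continuous_hittingDensity hc).intervalIntegrable _ _) hlim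
    (hcont.tendsto.mono_left nhdsWithin_le_nhds), sub_zero]
  intro s hs
  have hs0 : 0 < s := hs.1
  have hsq : Real.sqrt s ≠ 0 := by positivity
  have h1 : HasDerivAt (fun s : ℝ => c / Real.sqrt s) _ s :=
    (hasDerivAt_const s c).div (Real.hasDerivAt_sqrt hs0.ne') hsq
  have h2 := (((hasDerivAt_stdNormalCDF (c / Real.sqrt s)).comp s h1).const_sub 1).const_mul 2
  refine h2.congr_deriv ?_
  rw [hittingDensity_of_pos c hs0, div_pow, Real.sq_sqrt hs0.le,
    show -(c ^ 2 / s) / 2 = -c ^ 2 / (2 * s) by field_simp]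
  field_simp
  ring

end HittingDensity

section Convolution

lemma hasDerivAt_sqrt_inv_sub_inv {r s : ℝ} (hs : 0 < s) (hsr : s < r) :
    HasDerivAt (fun s : ℝ => Real.sqrt (s⁻¹ - r⁻¹))
      (-(Real.sqrt r / (2 * (s * Real.sqrt s) * Real.sqrt (r - s)))) s := by
  have hr : 0 < r := hs.trans hsr
  have hrs : 0 < r - s := sub_pos.2 hsr
  have hval : s⁻¹ - r⁻¹ = (r - s) / (s * r) := by field_simp
  have hpos : 0 < s⁻¹ - r⁻¹ := by rw [hval]; positivity
  refine (((hasDerivAt_inv hs.ne').sub_const r⁻¹).sqrt hpos.ne').congr_deriv ?_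
  rw [hval, Real.sqrt_div hrs.le, Real.sqrt_mul hs.le]
  have h1 : 0 < Real.sqrt (r - s) := Real.sqrt_pos.2 hrs
  have h2 : 0 < Real.sqrt s := Real.sqrt_pos.2 hs
  have h3 := Real.sq_sqrt hs.le
  field_simp
  linear_combination -h3

lemma sqrt_inv_sub_inv_mul {r s : ℝ} (hs : 0 < s) (hsr : s < r) :
    Real.sqrt (s⁻¹ - r⁻¹) * Real.sqrt ((r - s)⁻¹ - r⁻¹) = r⁻¹ := by
  have hr : 0 < r := hs.trans hsr
  have hrs : 0 < r - s := sub_pos.2 hsr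
  have h1 : 0 ≤ s⁻¹ - r⁻¹ := sub_nonneg.2 (inv_anti₀ hs hsr.le)
  rw [← Real.sqrt_mul h1, show (s⁻¹ - r⁻¹) * ((r - s)⁻¹ - r⁻¹) = r⁻¹ ^ 2 by field_simp; ring,
    Real.sqrt_sq (by positivity)]

lemma exp_mul_exp_hittingDensity (c d : ℝ) {r s : ℝ} (hs : 0 < s) (hsr : s < r) :
    Real.exp (-(c + d) ^ 2 / (2 * r)) *
      Real.exp (-(c * Real.sqrt (s⁻¹ - r⁻¹) - d * Real.sqrt ((r - s)⁻¹ - r⁻¹)) ^ 2 / 2) =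
    Real.exp (-c ^ 2 / (2 * s)) * Real.exp (-d ^ 2 / (2 * (r - s))) := by
  have hr : 0 < r := hs.trans hsr
  have hrs : 0 < r - s := sub_pos.2 hsr
  have h1 := Real.sq_sqrt (sub_nonneg.2 (inv_anti₀ hs hsr.le))
  have h2 := Real.sq_sqrt (sub_nonneg.2 (inv_anti₀ hrs (by linarith : r - s ≤ r)))
  have h3 := sqrt_inv_sub_inv_mul hs hsr
  rw [← Real.exp_add, ← Real.exp_add]
  congr 1
  have e : ∀ x y : ℝ, x / (2 * y) = x / 2 * y⁻¹ := fun x y => by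
    rw [div_eq_mul_inv, mul_inv]; ring
  simp only [e]
  linear_combination (-c ^ 2 / 2) * h1 + (-d ^ 2 / 2) * h2 + c * d * h3

lemma integral_hittingDensity_mul {c d r : ℝ} (hc : 0 < c) (hd : 0 < d) (hr : 0 < r) :
    ∫ s in (0 : ℝ)..r, hittingDensity c s * hittingDensity d (r - s) =
      hittingDensity (c + d) r := by
  let p : ℝ → ℝ := fun s => Real.sqrt (s⁻¹ - r⁻¹)
  let q : ℝ → ℝ := fun s => Real.sqrt ((r - s)⁻¹ - r⁻¹)
  let K : ℝ := 1 / (Real.sqrt (2 * Real.pi) * (r * Real.sqrt r))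
  let F : ℝ → ℝ := fun s => K *
    ((c - d) * Real.exp (-(c - d) ^ 2 / (2 * r)) * stdNormalCDF (c * p s + d * q s) -
      (c + d) * Real.exp (-(c + d) ^ 2 / (2 * r)) * stdNormalCDF (c * p s - d * q s))
  have hp_top : Tendsto p (𝓝[>] 0) atTop :=
    Real.tendsto_sqrt_atTop.comp
      (tendsto_atTop_add_const_right _ (-r⁻¹) tendsto_inv_nhdsGT_zero)
  have hq_zero : Tendsto q (𝓝[>] 0) (𝓝 0) := by
    have : ContinuousAt q 0 := by
      have h0 : r - 0 ≠ 0 := by simpa using hr.ne'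
      fun_prop (disch := assumption)
    simpa [q] using this.tendsto.mono_left nhdsWithin_le_nhds
  have hrefl : Tendsto (fun s => r - s) (𝓝[<] r) (𝓝[>] 0) := by
    refine tendsto_nhdsWithin_iff.2 ⟨?_, ?_⟩
    · have : Continuous fun s : ℝ => r - s := by fun_prop
      simpa using (this.tendsto r).mono_left nhdsWithin_le_nhds
    · filter_upwards [self_mem_nhdsWithin] with s hs using sub_pos.2 (mem_Iio.1 hs)
  have hq_top : Tendsto q (𝓝[<] r) atTop := hp_top.comp hrefl
  have hp_zero : Tendsto p (𝓝[<] r) (𝓝 0) :=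
    (hq_zero.comp hrefl).congr fun s => by simp [p, q]
  have hderiv : ∀ s ∈ Ioo 0 r,
      HasDerivAt F (hittingDensity c s * hittingDensity d (r - s)) s := by
    intro s hs
    have hs0 : 0 < s := hs.1
    have hrs : 0 < r - s := sub_pos.2 hs.2
    have hp := hasDerivAt_sqrt_inv_sub_inv hs0 hs.2
    have hq := (hasDerivAt_sqrt_inv_sub_inv (r := r) hrs (by linarith)).comp_const_sub r s
    rw [sub_sub_cancel] at hq
    have hA := (hasDerivAt_stdNormalCDF (c * p s + d * q s)).comp s
      ((hp.const_mul c).add (hq.const_mul d))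
    have hB := (hasDerivAt_stdNormalCDF (c * p s - d * q s)).comp s
      ((hp.const_mul c).sub (hq.const_mul d))
    refine (((hA.const_mul _).sub (hB.const_mul _)).const_mul K).congr_deriv ?_
    have e1 := exp_mul_exp_hittingDensity c d hs0 hs.2
    have e2 := exp_mul_exp_hittingDensity c (-d) hs0 hs.2
    simp only [← sub_eq_add_neg, neg_mul, sub_neg_eq_add, even_two, Even.neg_pow] at e2
    rw [hittingDensity_of_pos c hs0, hittingDensity_of_pos d hrs]
    set P := -(Real.sqrt r / (2 * (s * Real.sqrt s) * Real.sqrt (r - s))) with hP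
    set Q := -(Real.sqrt r / (2 * ((r - s) * Real.sqrt (r - s)) * Real.sqrt s)) with hQ
    set C := c / (Real.sqrt (2 * Real.pi) * (s * Real.sqrt s)) with hC
    set D := d / (Real.sqrt (2 * Real.pi) * ((r - s) * Real.sqrt (r - s))) with hD
    have halg : K * ((c - d) * (c * P + d * -Q) - (c + d) * (c * P - d * -Q)) /
        Real.sqrt (2 * Real.pi) = C * D := by
      have h1 : 0 < Real.sqrt s := Real.sqrt_pos.2 hs0
      have h2 : 0 < Real.sqrt (r - s) := Real.sqrt_pos.2 hrs
      simp only [K, hP, hQ, hC, hD]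
      field_simp
      ring
    linear_combination (K * (c - d) * (c * P + d * -Q) / Real.sqrt (2 * Real.pi)) * e2 -
      (K * (c + d) * (c * P - d * -Q) / Real.sqrt (2 * Real.pi)) * e1 +
      Real.exp (-c ^ 2 / (2 * s)) * Real.exp (-d ^ 2 / (2 * (r - s))) * halg
  have hint : IntervalIntegrable (fun s => hittingDensity c s * hittingDensity d (r - s))
      volume 0 r :=
    ((continuous_hittingDensity hc).mul
      ((continuous_hittingDensity hd).comp (continuous_sub_left r))).intervalIntegrable _ _
  have hplus0 : Tendsto (fun s => c * p s + d * q s) (𝓝[>] 0) atTop :=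
    (hp_top.const_mul_atTop hc).atTop_add (hq_zero.const_mul d)
  have hminus0 : Tendsto (fun s => c * p s - d * q s) (𝓝[>] 0) atTop := by
    simpa [sub_eq_add_neg] using (hp_top.const_mul_atTop hc).atTop_add (hq_zero.const_mul d).neg
  have hplusr : Tendsto (fun s => c * p s + d * q s) (𝓝[<] r) atTop :=
    (hp_zero.const_mul c).add_atTop (hq_top.const_mul_atTop hd)
  have hminusr : Tendsto (fun s => c * p s - d * q s) (𝓝[<] r) atBot := by
    simpa [sub_eq_add_neg] using (hp_zero.const_mul c).add_atBot
      (tendsto_neg_atTop_atBot.comp (hq_top.const_mul_atTop hd))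
  rw [intervalIntegral.integral_eq_sub_of_hasDerivAt_of_tendsto hr hderiv hint
    ((((tendsto_stdNormalCDF_atTop.comp hplus0).const_mul _).sub
      ((tendsto_stdNormalCDF_atTop.comp hminus0).const_mul _)).const_mul K)
    ((((tendsto_stdNormalCDF_atTop.comp hplusr).const_mul _).sub
      ((tendsto_stdNormalCDF_atBot.comp hminusr).const_mul _)).const_mul K),
    hittingDensity_of_pos _ hr]
  simp only [K]
  ring

lemma integral_hittingDensity_conv {c d : ℝ} (hc : 0 < c) (hd : 0 < d) {T t τ : ℝ} (hτ : 0 ≤ τ)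
    (ht : t ≤ T) :
    ∫ s in Ioc 0 T, hittingDensity c (t - s) * hittingDensity d (s - τ) =
      hittingDensity (c + d) (t - τ) := by
  rw [setIntegral_eq_integral_of_forall_compl_eq_zero]
  swap
  · intro s hs
    rcases le_or_gt s 0 with h | h
    · rw [hittingDensity_of_nonpos d (by linarith), mul_zero]
    · have : T < s := by by_contra! h'; exact hs ⟨h, h'⟩
      rw [hittingDensity_of_nonpos c (by linarith), zero_mul]
  have hshift := integral_sub_right_eq_self (μ := volume)
    (fun s => hittingDensity d s * hittingDensity c (t - τ - s)) τ
  have e : ∀ s, hittingDensity d (s - τ) * hittingDensity c (t - τ - (s - τ)) =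
      hittingDensity c (t - s) * hittingDensity d (s - τ) := fun s => by
    rw [mul_comm]; ring_nf
  simp_rw [e] at hshift
  rw [hshift]
  rcases le_or_gt (t - τ) 0 with h | h
  · rw [hittingDensity_of_nonpos _ h, integral_eq_zero_of_ae]
    refine ae_of_all _ fun s => ?_
    rcases le_or_gt s 0 with h' | h'
    · simp [hittingDensity_of_nonpos d h']
    · simp [hittingDensity_of_nonpos c (show t - τ - s ≤ 0 by linarith)]
  · rw [add_comm, ← integral_hittingDensity_mul hd hc h, intervalIntegral.integral_of_le h.le,
      setIntegral_eq_integral_of_forall_compl_eq_zero]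
    intro s hs
    rcases le_or_gt s 0 with h' | h'
    · simp [hittingDensity_of_nonpos d h']
    · have : t - τ < s := by by_contra! h''; exact hs ⟨h', h''⟩
      simp [hittingDensity_of_nonpos c (show t - τ - s ≤ 0 by linarith)]

end Convolution

section Renewal

/-- Fubini and the semigroup property for an iterated convolution on `(0, T]`. -/
lemma integral_hittingDensity_integral {c d T t : ℝ} (hc : 0 < c) (hd : 0 < d) (ht : t ≤ T)
    {f : ℝ → ℝ} (hf : IntegrableOn f (Ioc 0 T)) :
    ∫ s in Ioc 0 T, hittingDensity c (t - s) *
        ∫ τ in Ioc 0 T, hittingDensity d (s - τ) * f τ =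
      ∫ τ in Ioc 0 T, hittingDensity (c + d) (t - τ) * f τ := by
  have hcc := continuous_hittingDensity hc
  have hcd := continuous_hittingDensity hd
  have hint : Integrable (Function.uncurry fun s τ =>
      hittingDensity c (t - s) * hittingDensity d (s - τ) * f τ)
      ((volume.restrict (Ioc 0 T)).prod (volume.restrict (Ioc 0 T))) := by
    have hk : Continuous fun z : ℝ × ℝ =>
        hittingDensity c (t - z.1) * hittingDensity d (z.1 - z.2) :=
      (hcc.comp (by fun_prop)).mul (hcd.comp (by fun_prop))
    refine (Integrable.comp_snd hf _).bdd_mul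
      (c := 8 * Real.sqrt T / c ^ 3 * (8 * Real.sqrt T / d ^ 3)) hk.aestronglyMeasurable ?_
    rw [Measure.prod_restrict]
    refine (ae_restrict_iff' (measurableSet_Ioc.prod measurableSet_Ioc)).2
      (ae_of_all _ fun z hz => ?_)
    rw [norm_mul]
    have h1 := hz.1.1
    have h2 := hz.1.2
    have h3 := hz.2.1
    exact mul_le_mul (norm_hittingDensity_le hc (by linarith))
      (norm_hittingDensity_le hd (by linarith)) (norm_nonneg _) (by positivity)
  calc _ = ∫ s in Ioc 0 T, ∫ τ in Ioc 0 T,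
        hittingDensity c (t - s) * hittingDensity d (s - τ) * f τ := by
        simp_rw [mul_assoc, integral_const_mul]
    _ = ∫ τ in Ioc 0 T, ∫ s in Ioc 0 T,
        hittingDensity c (t - s) * hittingDensity d (s - τ) * f τ := integral_integral_swap hint
    _ = _ := by
        refine setIntegral_congr_fun measurableSet_Ioc fun τ hτ => ?_
        simp only [integral_mul_const, integral_hittingDensity_conv hc hd hτ.1.le ht]

lemma integrable_hittingDensity_mul {c T t : ℝ} (hc : 0 < c) {f : ℝ → ℝ}
    (hf : IntegrableOn f (Ioc 0 T)) :
    IntegrableOn (fun τ => hittingDensity c (t - τ) * f τ) (Ioc 0 T) := by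
  refine Integrable.bdd_mul (c := 8 * Real.sqrt t / c ^ 3) hf
    ((continuous_hittingDensity hc).comp (continuous_sub_left t)).aestronglyMeasurable ?_
  refine (ae_restrict_iff' measurableSet_Ioc).2 (ae_of_all _ fun τ hτ => ?_)
  exact norm_hittingDensity_le hc (by linarith [hτ.1])

/-- Substituting a renewal equation for `f` into a convolution. -/
lemma integral_hittingDensity_renewal {c d γ T : ℝ} (hc : 0 < c) (hd : 0 < d) (hγ : 0 < γ)
    {f g : ℝ → ℝ} (hg : IntegrableOn g (Ioc 0 T))
    (hf : ∀ s ∈ Ioc 0 T, f s =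
      hittingDensity γ s - ∫ τ in Ioc 0 T, hittingDensity d (s - τ) * g τ)
    (hfi : IntegrableOn f (Ioc 0 T)) :
    ∫ τ in Ioc 0 T, hittingDensity c (T - τ) * f τ =
      hittingDensity (c + γ) T - ∫ τ in Ioc 0 T, hittingDensity (c + d) (T - τ) * g τ := by
  have h1 := integral_hittingDensity_conv hc hγ (T := T) le_rfl le_rfl
  simp only [sub_zero] at h1
  have hi : IntegrableOn (fun s => hittingDensity c (T - s) * hittingDensity γ s) (Ioc 0 T) :=
    (((continuous_hittingDensity hc).comp (continuous_sub_left T)).mul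
      (continuous_hittingDensity hγ)).integrableOn_Ioc
  rw [← h1, ← integral_hittingDensity_integral hc hd le_rfl hg, eq_sub_iff_add_eq,
    ← eq_sub_iff_add_eq', ← integral_sub hi (integrable_hittingDensity_mul hc hfi)]
  refine setIntegral_congr_fun measurableSet_Ioc fun s hs => ?_
  simp only [hf s hs]
  ring

lemma summable_hittingDensity {c L : ℝ} (hc : 0 < c) (hL : 0 < L) (t : ℝ) :
    Summable fun k : ℕ => hittingDensity (c + 2 * (k : ℝ) * L) t := by
  have h := ((Real.summable_one_div_nat_add_rpow (c / (2 * L)) 3).2 (by norm_num)).mul_left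
    (8 * Real.sqrt t / (2 * L) ^ 3)
  refine Summable.of_nonneg_of_le (fun k => hittingDensity_nonneg (by positivity) t)
    (fun k => (hittingDensity_le (by positivity) t).trans_eq ?_) h
  rw [abs_of_pos (by positivity), show (3 : ℝ) = (3 : ℕ) by norm_num, Real.rpow_natCast,
    show c + 2 * (k : ℝ) * L = 2 * L * (k + c / (2 * L)) by field_simp; ring, mul_pow]
  field_simp

lemma tendsto_integral_hittingDensity {L T : ℝ} (hL : 0 < L) {f : ℝ → ℝ}
    (hf : IntegrableOn f (Ioc 0 T)) :
    Tendsto (fun n : ℕ => ∫ τ in Ioc 0 T, hittingDensity (2 * ((n : ℝ) + 1) * L) (T - τ) * f τ)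
      atTop (𝓝 0) := by
  have hb : ∀ n : ℕ, ‖∫ τ in Ioc 0 T, hittingDensity (2 * ((n : ℝ) + 1) * L) (T - τ) * f τ‖ ≤
      8 * Real.sqrt T / (2 * L) ^ 3 * (1 / ((n : ℝ) + 1)) * ∫ τ in Ioc 0 T, ‖f τ‖ := by
    intro n
    rw [← integral_const_mul]
    refine norm_integral_le_of_norm_le (hf.norm.const_mul _)
      ((ae_restrict_iff' measurableSet_Ioc).2 (ae_of_all _ fun τ hτ => ?_))
    rw [norm_mul]
    refine mul_le_mul_of_nonneg_right ((norm_hittingDensity_le (T := T) (by positivity)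
      (by linarith [hτ.1])).trans ?_) (norm_nonneg _)
    rw [show 2 * ((n : ℝ) + 1) * L = 2 * L * (n + 1) by ring, mul_pow, ← div_div,
      div_eq_mul_one_div _ (((n : ℝ) + 1) ^ 3)]
    gcongr
    exact le_self_pow₀ (by linarith [(Nat.cast_nonneg n : (0 : ℝ) ≤ n)]) (by norm_num)
  refine squeeze_zero_norm hb ?_
  simpa using (tendsto_one_div_add_atTop_nhds_zero_nat.const_mul
    (8 * Real.sqrt T / (2 * L) ^ 3)).mul_const (∫ τ in Ioc 0 T, ‖f τ‖)

/-- Iterating the coupled renewal equations yields the image series. -/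
lemma eq_tsum_of_renewal {α β L T : ℝ} (hα : 0 < α) (hβ : 0 < β) (hL : α + β = L) (hT : 0 < T)
    {u v : ℝ → ℝ} (hui : IntegrableOn u (Ioc 0 T)) (hvi : IntegrableOn v (Ioc 0 T))
    (hu : ∀ s ∈ Ioc 0 T, u s =
      hittingDensity α s - ∫ τ in Ioc 0 T, hittingDensity L (s - τ) * v τ)
    (hv : ∀ s ∈ Ioc 0 T, v s =
      hittingDensity β s - ∫ τ in Ioc 0 T, hittingDensity L (s - τ) * u τ) :
    u T = ∑' k : ℤ, hittingDensity (α + 2 * (k : ℝ) * L) T := by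
  have hL0 : 0 < L := by linarith
  have hstep : ∀ c, 0 < c → ∫ τ in Ioc 0 T, hittingDensity c (T - τ) * u τ =
      hittingDensity (c + α) T - hittingDensity (c + L + β) T +
        ∫ τ in Ioc 0 T, hittingDensity (c + L + L) (T - τ) * u τ := by
    intro c hc
    rw [integral_hittingDensity_renewal hc hL0 hα hvi hu hui,
      integral_hittingDensity_renewal (by positivity) hL0 hβ hui hv hvi]
    ring
  have hsum : ∀ n : ℕ, u T =
      (∑ k ∈ Finset.range (n + 1), (hittingDensity (α + 2 * (k : ℝ) * L) T -
        hittingDensity (L + β + 2 * (k : ℝ) * L) T)) +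
      ∫ τ in Ioc 0 T, hittingDensity (2 * ((n : ℝ) + 1) * L) (T - τ) * u τ := by
    intro n
    induction n with
    | zero =>
      rw [hu T ⟨hT, le_rfl⟩, integral_hittingDensity_renewal hL0 hL0 hβ hui hv hvi]
      simp
      ring_nf
    | succ n ih =>
      rw [Finset.sum_range_succ, ih, hstep _ (by positivity)]
      push_cast
      rw [show 2 * ((n : ℝ) + 1) * L + α = α + 2 * (n + 1) * L by ring,
        show 2 * ((n : ℝ) + 1) * L + L + β = L + β + 2 * (n + 1) * L by ring,
        show 2 * ((n : ℝ) + 1) * L + L + L = 2 * (n + 1 + 1) * L by ring]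
      ring
  have h1 := (summable_hittingDensity hα hL0 T).hasSum
  have h2 := (summable_hittingDensity (c := L + β) (by positivity) hL0 T).hasSum
  have hlim := (((h1.sub h2).tendsto_sum_nat.comp (tendsto_add_atTop_nat 1)).add
    (tendsto_integral_hittingDensity hL0 hui))
  have huT := tendsto_nhds_unique (tendsto_const_nhds.congr hsum) hlim
  have hneg : (fun k : ℕ => hittingDensity (α + 2 * ((-((k : ℤ) + 1) : ℤ) : ℝ) * L) T) =
      fun k : ℕ => -hittingDensity (L + β + 2 * (k : ℝ) * L) T := by
    funext k
    rw [← hittingDensity_neg]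
    congr 1
    push_cast
    linear_combination hL
  have h3 : HasSum (fun k : ℤ => hittingDensity (α + 2 * (k : ℝ) * L) T) (_ + _) :=
    HasSum.of_nat_of_neg_add_one (by simpa using h1) (hneg ▸ h2.neg)
  rw [h3.tsum_eq, huT]
  ring

end Renewal

section Differentiation

lemma hasDerivAt_integral_hittingDensity {c : ℝ} (hc : 0 < c) (t : ℝ) :
    HasDerivAt (fun t => ∫ s in (0 : ℝ)..t, hittingDensity c s) (hittingDensity c t) t :=
  intervalIntegral.integral_hasDerivAt_right
    ((continuous_hittingDensity hc).intervalIntegrable _ _)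
    (continuous_hittingDensity hc).aestronglyMeasurable.stronglyMeasurableAtFilter
    (continuous_hittingDensity hc).continuousAt

lemma hasDerivAt_integral_kernel {c T t : ℝ} (hc : 0 < c) {f : ℝ → ℝ}
    (hf : IntegrableOn f (Ioc 0 T)) :
    HasDerivAt
      (fun t => ∫ τ in Ioc 0 T, (∫ s in (0 : ℝ)..(t - τ), hittingDensity c s) * f τ)
      (∫ τ in Ioc 0 T, hittingDensity c (t - τ) * f τ) t := by
  have hH : Continuous fun t => ∫ s in (0 : ℝ)..t, hittingDensity c s :=
    continuous_iff_continuousAt.2 fun t => (hasDerivAt_integral_hittingDensity hc t).continuousAt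
  have hm : ∀ t, Continuous fun τ => ∫ s in (0 : ℝ)..(t - τ), hittingDensity c s :=
    fun t => hH.comp (continuous_sub_left t)
  have hfi : Integrable (fun τ => (∫ s in (0 : ℝ)..(t - τ), hittingDensity c s) * f τ)
      (volume.restrict (Ioc 0 T)) := by
    obtain ⟨C, hC⟩ := (isCompact_Icc (a := (0 : ℝ)) (b := T)).exists_bound_of_continuousOn
      (hm t).continuousOn
    exact hf.bdd_mul (hm t).aestronglyMeasurable ((ae_restrict_iff' measurableSet_Ioc).2
      (ae_of_all _ fun τ hτ => hC τ (Ioc_subset_Icc_self hτ)))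
  refine (hasDerivAt_integral_of_dominated_loc_of_deriv_le
    (F' := fun t τ => hittingDensity c (t - τ) * f τ)
    (bound := fun τ => 8 * Real.sqrt (t + 1) / c ^ 3 * ‖f τ‖) (Iio_mem_nhds (lt_add_one t))
    (Eventually.of_forall fun t => ?_) hfi
    (integrable_hittingDensity_mul hc hf).aestronglyMeasurable ?_ (hf.norm.const_mul _) ?_).2
  · exact (hm t).aestronglyMeasurable.mul hf.aestronglyMeasurable
  · refine (ae_restrict_iff' measurableSet_Ioc).2 (ae_of_all _ fun τ hτ x hx => ?_)
    rw [norm_mul]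
    exact mul_le_mul_of_nonneg_right
      (norm_hittingDensity_le hc (by linarith [hτ.1, mem_Iio.1 hx])) (norm_nonneg _)
  · refine ae_of_all _ fun τ x _ => ?_
    exact ((hasDerivAt_integral_hittingDensity hc (x - τ)).comp_sub_const x τ).mul_const _

/-- Differentiating a first-kind equation yields a second-kind renewal equation. -/
lemma renewal_of_integral_eq {γ L : ℝ} (hγ : 0 < γ) (hL : 0 < L) {f g : ℝ → ℝ}
    (hgC : ContinuousOn g (Ioi 0)) (hf : ∀ t, 0 < t → IntegrableOn f (Ioc 0 t))
    (hg : ∀ t, 0 < t → IntegrableOn g (Ioc 0 t))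
    (h : ∀ t, 0 < t → 1 - stdNormalCDF (γ / Real.sqrt t) =
      (∫ τ in (0 : ℝ)..t, (1 - stdNormalCDF (L / Real.sqrt (t - τ))) * f τ) +
        (1 / 2) * ∫ τ in (0 : ℝ)..t, g τ)
    {T : ℝ} :
    ∀ s ∈ Ioc 0 T, g s = hittingDensity γ s - ∫ τ in Ioc 0 T, hittingDensity L (s - τ) * f τ := by
  intro s hs
  have hs0 : 0 < s := hs.1
  have hT : 0 < T := hs0.trans_le hs.2
  have hker : ∀ t ∈ Ioo 0 (T + 1),
      ∫ τ in Ioc 0 (T + 1), (∫ r in (0 : ℝ)..(t - τ), hittingDensity L r) * f τ =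
        2 * ∫ τ in (0 : ℝ)..t, (1 - stdNormalCDF (L / Real.sqrt (t - τ))) * f τ := by
    intro t ht
    rw [setIntegral_eq_of_subset_of_forall_sdiff_eq_zero measurableSet_Ioc
      (Ioc_subset_Ioc_right ht.2.le) (fun τ hτ => ?_), intervalIntegral.integral_of_le ht.1.le,
      ← integral_const_mul, integral_Ioc_eq_integral_Ioo, integral_Ioc_eq_integral_Ioo]
    · refine setIntegral_congr_fun measurableSet_Ioo fun τ hτ => ?_
      simp only [integral_hittingDensity hL (sub_pos.2 hτ.2)]
      ring
    · have hle : t - τ ≤ 0 := by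
        by_contra! h'
        exact hτ.2 ⟨hτ.1.1, by linarith⟩
      rw [intervalIntegral.integral_of_ge hle, setIntegral_eq_zero_of_forall_eq_zero
        fun r hr => hittingDensity_of_nonpos L hr.2]
      simp
  have hgs : HasDerivAt (fun t => ∫ τ in (0 : ℝ)..t, g τ) (g s) s :=
    intervalIntegral.integral_hasDerivAt_right
      ((intervalIntegrable_iff_integrableOn_Ioc_of_le hs0.le).2 (hg s hs0))
      (hgC.stronglyMeasurableAtFilter isOpen_Ioi s hs0) (hgC.continuousAt (Ioi_mem_nhds hs0))
  have hsum := (hasDerivAt_integral_kernel (t := s) hL (hf (T + 1) (by linarith))).add hgs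
  have heq : (fun t => ∫ r in (0 : ℝ)..t, hittingDensity γ r) =ᶠ[𝓝 s]
      (fun t => ∫ τ in Ioc 0 (T + 1), (∫ r in (0 : ℝ)..(t - τ), hittingDensity L r) * f τ) +
        fun t => ∫ τ in (0 : ℝ)..t, g τ := by
    filter_upwards [Ioo_mem_nhds hs0 (by linarith [hs.2] : s < T + 1)] with t ht
    rw [Pi.add_apply, hker t ht, integral_hittingDensity hγ ht.1, h t ht.1]
    ring
  have := (hasDerivAt_integral_hittingDensity hγ s).unique (hsum.congr_of_eventuallyEq heq)
  rw [setIntegral_eq_of_subset_of_forall_sdiff_eq_zero measurableSet_Ioc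
    (Ioc_subset_Ioc_right (by linarith : T ≤ T + 1)) (fun τ hτ => ?_)] at this
  · linarith
  · have : T < τ := by
      by_contra! h'
      exact hτ.2 ⟨hτ.1.1, h'⟩
    rw [hittingDensity_of_nonpos L (by linarith [hs.2]), zero_mul]

end Differentiation

theorem stmt_8 (a x0 b : ℝ) (hax : a < x0) (hxb : x0 < b) (u v : ℝ → ℝ)
    (huC : ContinuousOn u (Set.Ioi 0)) (hvC : ContinuousOn v (Set.Ioi 0))
    (huI : ∀ t : ℝ, 0 < t → IntegrableOn u (Set.Ioc 0 t))
    (hvI : ∀ t : ℝ, 0 < t → IntegrableOn v (Set.Ioc 0 t))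
    (heq1 : ∀ t : ℝ, 0 < t →
      1 - stdNormalCDF ((b - x0) / Real.sqrt t) =
        (∫ τ in (0 : ℝ)..t, (1 - stdNormalCDF ((b - a) / Real.sqrt (t - τ))) * u τ) +
        (1 / 2) * ∫ τ in (0 : ℝ)..t, v τ)
    (heq2 : ∀ t : ℝ, 0 < t →
      stdNormalCDF ((a - x0) / Real.sqrt t) =
        (1 / 2) * (∫ τ in (0 : ℝ)..t, u τ) +
        ∫ τ in (0 : ℝ)..t, stdNormalCDF ((a - b) / Real.sqrt (t - τ)) * v τ) :
    ∀ t : ℝ, 0 < t →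
      u t = (∑' k : ℤ, (x0 - a + 2 * (k : ℝ) * (b - a)) / Real.sqrt (2 * Real.pi * t ^ 3) *
              Real.exp (-(x0 - a + 2 * (k : ℝ) * (b - a)) ^ 2 / (2 * t))) ∧
      v t = (∑' k : ℤ, (b - x0 + 2 * (k : ℝ) * (b - a)) / Real.sqrt (2 * Real.pi * t ^ 3) *
              Real.exp (-(b - x0 + 2 * (k : ℝ) * (b - a)) ^ 2 / (2 * t))) := by
  have hα : 0 < x0 - a := sub_pos.2 hax
  have hβ : 0 < b - x0 := sub_pos.2 hxb
  have hL : 0 < b - a := by linarith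
  have heq2' : ∀ t : ℝ, 0 < t → 1 - stdNormalCDF ((x0 - a) / Real.sqrt t) =
      (∫ τ in (0 : ℝ)..t, (1 - stdNormalCDF ((b - a) / Real.sqrt (t - τ))) * v τ) +
        (1 / 2) * ∫ τ in (0 : ℝ)..t, u τ := by
    intro t ht
    have h := heq2 t ht
    simp only [← neg_sub x0 a, ← neg_sub b a, neg_div _ (x0 - a), neg_div _ (b - a),
      stdNormalCDF_neg] at h
    rw [h, add_comm]
  intro t ht
  have hu := renewal_of_integral_eq hα hL huC hvI huI heq2' (T := t)
  have hv := renewal_of_integral_eq hβ hL hvC huI hvI heq1 (T := t)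
  exact ⟨eq_tsum_of_renewal hα hβ (by ring) ht (huI t ht) (hvI t ht) hu hv,
    eq_tsum_of_renewal hβ hα (by ring) ht (hvI t ht) (huI t ht) hv hu⟩
end

section
/- Let a < x0 < b be real numbers and let g_a(t) = Σ_{k ∈ ℤ} (x0 − a + 2k(b−a))/√(2π t³) · exp(−(x0 − a + 2k(b−a))²/(2t)) for t > 0. Then for every λ > 0, ∫_0^∞ e^{−λ t} g_a(t) dt = sinh( √(2λ)·(b − x0) ) / sinh( √(2λ)·(b − a) ). -/
open MeasureTheory Set

section BrownianHitting

open Filter Topology ProbabilityTheory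

/-- The cumulative distribution function of the standard Gaussian has the Gaussian density as its
derivative. -/
lemma hasDerivAt_cdf_gaussianReal (x : ℝ) :
    HasDerivAt (fun y => cdf (gaussianReal 0 1) y)
      ((Real.sqrt (2 * Real.pi))⁻¹ * Real.exp (-x ^ 2 / 2)) x := by
  have hint : Integrable (gaussianPDFReal 0 1) := integrable_gaussianPDFReal 0 1
  have hcdf : ∀ y, cdf (gaussianReal 0 1) y = ∫ u in Iic y, gaussianPDFReal 0 1 u := by
    intro y
    rw [cdf_eq_real, measureReal_def, gaussianReal_apply_eq_integral 0 one_ne_zero,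
      ENNReal.toReal_ofReal]
    exact integral_nonneg fun u => gaussianPDFReal_nonneg 0 1 u
  have hcont : Continuous (gaussianPDFReal 0 1) := by
    unfold gaussianPDFReal
    fun_prop
  have hderiv := (intervalIntegral.integral_hasDerivAt_right
    (hint.intervalIntegrable (a := 0) (b := x))
    hcont.stronglyMeasurable.stronglyMeasurableAtFilter hcont.continuousAt).const_add
      (∫ u in Iic (0 : ℝ), gaussianPDFReal 0 1 u)
  have heq : (fun y => cdf (gaussianReal 0 1) y) = fun y =>
      (∫ u in Iic (0 : ℝ), gaussianPDFReal 0 1 u) + ∫ u in (0 : ℝ)..y, gaussianPDFReal 0 1 u := by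
    funext y
    rw [hcdf, ← intervalIntegral.integral_Iic_sub_Iic hint.integrableOn hint.integrableOn]
    ring
  rw [heq]
  refine hderiv.congr_deriv ?_
  simp [gaussianPDFReal]

/-- The first passage density of standard Brownian motion to distance `c`, multiplied by the
Laplace weight `exp (-lam * t)`. It is odd in `c`. -/
noncomputable def hittingTerm (lam c t : ℝ) : ℝ :=
  Real.exp (-lam * t) *
    (c / Real.sqrt (2 * Real.pi * t ^ 3) * Real.exp (-c ^ 2 / (2 * t)))

/-- The distribution function, damped by `exp (-s * c)`, of the first passage time to `c` for
Brownian motion with drift `s`. -/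
noncomputable def driftHittingCDF (s c t : ℝ) : ℝ :=
  Real.exp (-(s * c)) * cdf (gaussianReal 0 1) (s * Real.sqrt t - c / Real.sqrt t) +
    Real.exp (s * c) * cdf (gaussianReal 0 1) (-(s * Real.sqrt t + c / Real.sqrt t))

lemma hasDerivAt_driftHittingCDF {s lam : ℝ} (hs : s ^ 2 = 2 * lam) (c : ℝ) {t : ℝ}
    (ht : 0 < t) : HasDerivAt (driftHittingCDF s c) (hittingTerm lam c t) t := by
  obtain ⟨r, hr, rfl⟩ : ∃ r : ℝ, 0 < r ∧ t = r ^ 2 :=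
    ⟨Real.sqrt t, Real.sqrt_pos.2 ht, (Real.sq_sqrt ht.le).symm⟩
  have hsq : Real.sqrt (r ^ 2) = r := Real.sqrt_sq hr.le
  have h1 : HasDerivAt Real.sqrt (1 / (2 * r)) (r ^ 2) := by
    simpa [hsq] using Real.hasDerivAt_sqrt ht.ne'
  have h2 : HasDerivAt (fun t => c / Real.sqrt t) (-(c / (2 * r ^ 3))) (r ^ 2) := by
    refine ((hasDerivAt_const (r ^ 2) c).div h1 (by rw [hsq]; exact hr.ne')).congr_deriv ?_
    rw [hsq]
    field_simp
    ring
  have h3 := (hasDerivAt_cdf_gaussianReal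
    (s * Real.sqrt (r ^ 2) - c / Real.sqrt (r ^ 2))).comp (r ^ 2) ((h1.const_mul s).sub h2)
  have h4 := (hasDerivAt_cdf_gaussianReal
    (-(s * Real.sqrt (r ^ 2) + c / Real.sqrt (r ^ 2)))).comp (r ^ 2) ((h1.const_mul s).add h2).neg
  refine ((h3.const_mul (Real.exp (-(s * c)))).add
    (h4.const_mul (Real.exp (s * c)))).congr_deriv ?_
  have hlam : lam = s ^ 2 / 2 := by linarith
  have e1 : Real.exp (-(s * c)) * Real.exp (-(s * r - c / r) ^ 2 / 2) =
      Real.exp (-lam * r ^ 2) * Real.exp (-c ^ 2 / (2 * r ^ 2)) := by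
    rw [← Real.exp_add, ← Real.exp_add, hlam]
    congr 1
    field_simp
    ring
  have e2 : Real.exp (s * c) * Real.exp (-(-(s * r + c / r)) ^ 2 / 2) =
      Real.exp (-lam * r ^ 2) * Real.exp (-c ^ 2 / (2 * r ^ 2)) := by
    rw [← Real.exp_add, ← Real.exp_add, hlam]
    congr 1
    field_simp
    ring
  have hsqrt : Real.sqrt (2 * Real.pi * (r ^ 2) ^ 3) = Real.sqrt (2 * Real.pi) * r ^ 3 := by
    rw [Real.sqrt_mul (by positivity), show (r ^ 2) ^ 3 = (r ^ 3) ^ 2 by ring,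
      Real.sqrt_sq (by positivity)]
  have hpi : Real.sqrt (2 * Real.pi) ≠ 0 := by positivity
  rw [hittingTerm, hsqrt, hsq]
  symm
  calc _ = (Real.exp (-lam * r ^ 2) * Real.exp (-c ^ 2 / (2 * r ^ 2))) *
        ((Real.sqrt (2 * Real.pi))⁻¹ * (s * (1 / (2 * r)) - -(c / (2 * r ^ 3)))) +
      (Real.exp (-lam * r ^ 2) * Real.exp (-c ^ 2 / (2 * r ^ 2))) *
        ((Real.sqrt (2 * Real.pi))⁻¹ * -(s * (1 / (2 * r)) + -(c / (2 * r ^ 3)))) := by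
        field_simp
        ring
    _ = _ := by
        nth_rewrite 1 [← e1]
        rw [← e2]
        ring

lemma tendsto_driftHittingCDF_zero {s c : ℝ} (hc : 0 < c) :
    Tendsto (driftHittingCDF s c) (𝓝[>] 0) (𝓝 0) := by
  have hsqrt : Tendsto Real.sqrt (𝓝[>] 0) (𝓝[>] 0) := by
    refine tendsto_nhdsWithin_of_tendsto_nhds_of_eventually_within _ ?_ ?_
    · simpa using (Real.continuous_sqrt.tendsto 0).mono_left nhdsWithin_le_nhds
    · filter_upwards [self_mem_nhdsWithin] with t ht using Real.sqrt_pos.2 ht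
  have hs : Tendsto (fun t => s * Real.sqrt t) (𝓝[>] 0) (𝓝 (s * 0)) :=
    (hsqrt.mono_right nhdsWithin_le_nhds).const_mul s
  have hdiv : Tendsto (fun t => c / Real.sqrt t) (𝓝[>] 0) atTop := by
    simpa only [div_eq_mul_inv, Function.comp_def] using
      (tendsto_inv_nhdsGT_zero.comp hsqrt).const_mul_atTop hc
  have h1 : Tendsto (fun t => s * Real.sqrt t - c / Real.sqrt t) (𝓝[>] 0) atBot := by
    simpa only [sub_eq_add_neg, Function.comp_def] using hs.add_atBot (tendsto_neg_atTop_atBot.comp hdiv)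
  have h2 : Tendsto (fun t => -(s * Real.sqrt t + c / Real.sqrt t)) (𝓝[>] 0) atBot :=
    tendsto_neg_atTop_atBot.comp (hs.add_atTop hdiv)
  simpa [Function.comp_def, neg_add_rev, funext (driftHittingCDF.eq_1 s c)] using (((tendsto_cdf_atBot
    (gaussianReal 0 1)).comp h1).const_mul
    (Real.exp (-(s * c)))).add
      (((tendsto_cdf_atBot (gaussianReal 0 1)).comp h2).const_mul (Real.exp (s * c)))

lemma tendsto_driftHittingCDF_atTop {s : ℝ} (hs : 0 < s) (c : ℝ) :
    Tendsto (driftHittingCDF s c) atTop (𝓝 (Real.exp (-(s * c)))) := by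
  have hsqrt : Tendsto (fun t => s * Real.sqrt t) atTop atTop :=
    Real.tendsto_sqrt_atTop.const_mul_atTop hs
  have hdiv : Tendsto (fun t => c / Real.sqrt t) atTop (𝓝 0) :=
    tendsto_const_nhds.div_atTop Real.tendsto_sqrt_atTop
  have h1 : Tendsto (fun t => s * Real.sqrt t - c / Real.sqrt t) atTop atTop := by
    simpa only [sub_eq_add_neg] using hsqrt.atTop_add hdiv.neg
  have h2 : Tendsto (fun t => -(s * Real.sqrt t + c / Real.sqrt t)) atTop atBot :=
    tendsto_neg_atTop_atBot.comp (hsqrt.atTop_add hdiv)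
  simpa [Function.comp_def, neg_add_rev, funext (driftHittingCDF.eq_1 s c)] using (((tendsto_cdf_atTop
    (gaussianReal 0 1)).comp h1).const_mul
    (Real.exp (-(s * c)))).add
      (((tendsto_cdf_atBot (gaussianReal 0 1)).comp h2).const_mul (Real.exp (s * c)))

lemma hittingTerm_nonneg {c : ℝ} (hc : 0 ≤ c) (lam t : ℝ) : 0 ≤ hittingTerm lam c t := by
  unfold hittingTerm
  positivity

lemma hittingTerm_neg (lam c t : ℝ) : hittingTerm lam (-c) t = -hittingTerm lam c t := by
  simp only [hittingTerm, neg_sq]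
  ring

lemma norm_hittingTerm (lam c t : ℝ) : ‖hittingTerm lam c t‖ = hittingTerm lam |c| t := by
  rw [Real.norm_eq_abs]
  rcases le_total 0 c with hc | hc
  · rw [abs_of_nonneg hc, abs_of_nonneg (hittingTerm_nonneg hc lam t)]
  · rw [abs_of_nonpos hc, ← abs_neg, ← hittingTerm_neg,
      abs_of_nonneg (hittingTerm_nonneg (neg_nonneg.2 hc) lam t)]

lemma integrableOn_and_integral_hittingTerm_of_pos {s lam c : ℝ} (hs : 0 < s)
    (hlam : s ^ 2 = 2 * lam) (hc : 0 < c) :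
    IntegrableOn (hittingTerm lam c) (Ioi 0) ∧
      ∫ t in Ioi (0 : ℝ), hittingTerm lam c t = Real.exp (-(s * c)) := by
  set G : ℝ → ℝ := Function.update (driftHittingCDF s c) 0 0 with hG
  have hcont : ContinuousWithinAt G (Ici 0) 0 := by
    rw [hG, continuousWithinAt_update_same, Ici_sdiff_left]
    exact tendsto_driftHittingCDF_zero hc
  have hderiv : ∀ t ∈ Ioi (0 : ℝ), HasDerivAt G (hittingTerm lam c t) t := by
    intro t ht
    refine (hasDerivAt_driftHittingCDF hlam c ht).congr_of_eventuallyEq ?_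
    filter_upwards [Ioi_mem_nhds ht] with u hu
    exact Function.update_of_ne (ne_of_gt hu) _ _
  have hpos : ∀ t ∈ Ioi (0 : ℝ), 0 ≤ hittingTerm lam c t :=
    fun t _ => hittingTerm_nonneg hc.le lam t
  have hlim : Tendsto G atTop (𝓝 (Real.exp (-(s * c)))) := by
    refine (tendsto_driftHittingCDF_atTop hs c).congr' ?_
    filter_upwards [Ioi_mem_atTop (0 : ℝ)] with u hu
    exact (Function.update_of_ne (ne_of_gt hu) _ _).symm
  refine ⟨integrableOn_Ioi_deriv_of_nonneg hcont hderiv hpos hlim, ?_⟩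
  rw [integral_Ioi_of_hasDerivAt_of_nonneg hcont hderiv hpos hlim]
  simp [hG]

lemma integrableOn_and_integral_hittingTerm_of_neg {s lam c : ℝ} (hs : 0 < s)
    (hlam : s ^ 2 = 2 * lam) (hc : c < 0) :
    IntegrableOn (hittingTerm lam c) (Ioi 0) ∧
      ∫ t in Ioi (0 : ℝ), hittingTerm lam c t = -Real.exp (s * c) := by
  obtain ⟨h1, h2⟩ := integrableOn_and_integral_hittingTerm_of_pos hs hlam (neg_pos.2 hc)
  have heq : hittingTerm lam c = fun t => -hittingTerm lam (-c) t := by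
    funext t
    rw [hittingTerm_neg, neg_neg]
  rw [heq]
  refine ⟨h1.neg, ?_⟩
  rw [integral_neg, h2]
  ring_nf

/-- Summation of the Laplace transforms over all reflected images. -/
lemma hasSum_integral_hittingTerm {s lam z L : ℝ} (hs : 0 < s) (hlam : s ^ 2 = 2 * lam)
    (hz : 0 < z) (hzL : z < L) :
    HasSum (fun k : ℤ => ∫ t in Ioi (0 : ℝ), hittingTerm lam (z + 2 * (k : ℝ) * L) t)
      (Real.sinh (s * (L - z)) / Real.sinh (s * L)) := by
  have hL : 0 < L := hz.trans hzL
  set q : ℝ := Real.exp (-(2 * s * L)) with hq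
  have hq1 : q < 1 := by
    rw [hq, ← Real.exp_zero, Real.exp_lt_exp]
    have := mul_pos hs hL
    linarith
  have hgeom := hasSum_geometric_of_lt_one (hq ▸ (Real.exp_pos _).le : 0 ≤ q) hq1
  have hqpow : ∀ n : ℕ, q ^ n = Real.exp (-(2 * s * L) * n) := by
    intro n
    rw [hq, ← Real.exp_nat_mul]
    ring_nf
  have hpos : HasSum (fun n : ℕ =>
      ∫ t in Ioi (0 : ℝ), hittingTerm lam (z + 2 * (((n : ℤ) : ℝ)) * L) t)
      (Real.exp (-(s * z)) * (1 - q)⁻¹) := by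
    convert! hgeom.mul_left (Real.exp (-(s * z))) using 2 with n
    rw [(integrableOn_and_integral_hittingTerm_of_pos hs hlam
      (by push_cast; positivity)).2, hqpow, ← Real.exp_add]
    push_cast
    ring_nf
  have hneg : HasSum (fun n : ℕ =>
      ∫ t in Ioi (0 : ℝ), hittingTerm lam (z + 2 * ((-((n : ℤ) + 1) : ℤ) : ℝ) * L) t)
      (-(Real.exp (s * z) * q) * (1 - q)⁻¹) := by
    convert! hgeom.mul_left (-(Real.exp (s * z) * q)) using 2 with n
    have hn : z + 2 * ((-((n : ℤ) + 1) : ℤ) : ℝ) * L < 0 := by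
      push_cast
      have : (0 : ℝ) ≤ n * L := by positivity
      nlinarith
    rw [(integrableOn_and_integral_hittingTerm_of_neg hs hlam hn).2, hqpow, hq, neg_mul,
      ← Real.exp_add, ← Real.exp_add]
    push_cast
    ring_nf
  suffices hval : Real.sinh (s * (L - z)) / Real.sinh (s * L) =
      Real.exp (-(s * z)) * (1 - q)⁻¹ + -(Real.exp (s * z) * q) * (1 - q)⁻¹ by
    rw [hval]
    exact hpos.of_nat_of_neg_add_one hneg
  have hsinh : Real.sinh (s * L) ≠ 0 := (Real.sinh_pos_iff.2 (mul_pos hs hL)).ne'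
  have hq0 : 1 - q ≠ 0 := by linarith
  rw [← add_mul, ← div_eq_mul_inv, div_eq_div_iff hsinh hq0, Real.sinh_eq, Real.sinh_eq, hq]
  have h1 : Real.exp (s * (L - z)) = Real.exp (s * L) * Real.exp (-(s * z)) := by
    rw [← Real.exp_add]; ring_nf
  have h2 : Real.exp (-(s * (L - z))) = Real.exp (-(s * L)) * Real.exp (s * z) := by
    rw [← Real.exp_add]; ring_nf
  have h3 : Real.exp (-(2 * s * L)) = Real.exp (-(s * L)) * Real.exp (-(s * L)) := by
    rw [← Real.exp_add]; ring_nf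
  have h4 : Real.exp (s * L) * Real.exp (-(s * L)) = 1 := by
    rw [← Real.exp_add]; simp
  rw [h1, h2, h3]
  linear_combination (-(1 / 2) * Real.exp (-(s * L)) * Real.exp (-(s * z)) +
    (1 / 2) * Real.exp (-(s * L)) * Real.exp (s * z)) * h4

end BrownianHitting

theorem stmt_9 (a x0 b : ℝ) (hax : a < x0) (hxb : x0 < b) :
    ∀ lam : ℝ, 0 < lam →
      (∫ t in Set.Ioi (0 : ℝ),
        Real.exp (-lam * t) *
          ∑' k : ℤ, (x0 - a + 2 * (k : ℝ) * (b - a)) / Real.sqrt (2 * Real.pi * t ^ 3) *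
            Real.exp (-(x0 - a + 2 * (k : ℝ) * (b - a)) ^ 2 / (2 * t))) =
      Real.sinh (Real.sqrt (2 * lam) * (b - x0)) / Real.sinh (Real.sqrt (2 * lam) * (b - a)) := by
  intro lam hlam
  have hs : 0 < Real.sqrt (2 * lam) := by positivity
  have hs2 : Real.sqrt (2 * lam) ^ 2 = 2 * lam := Real.sq_sqrt (by positivity)
  have hsum := hasSum_integral_hittingTerm (z := x0 - a) (L := b - a) hs hs2
    (by linarith) (by linarith)
  have hterm : ∀ k : ℤ,
      IntegrableOn (hittingTerm lam (x0 - a + 2 * (k : ℝ) * (b - a))) (Ioi 0) ∧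
        ∫ t in Ioi (0 : ℝ), ‖hittingTerm lam (x0 - a + 2 * (k : ℝ) * (b - a)) t‖ =
          |∫ t in Ioi (0 : ℝ), hittingTerm lam (x0 - a + 2 * (k : ℝ) * (b - a)) t| := by
    intro k
    simp only [norm_hittingTerm]
    have hne : x0 - a + 2 * (k : ℝ) * (b - a) ≠ 0 := by
      intro h0
      rcases le_or_gt 0 k with hk | hk
      · have hk' : (0 : ℝ) ≤ k := by exact_mod_cast hk
        nlinarith [mul_nonneg hk' (by linarith : (0 : ℝ) ≤ b - a)]
      · have hk' : (k : ℝ) ≤ -1 := by exact_mod_cast Int.le_sub_one_of_lt hk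
        nlinarith
    rcases lt_or_gt_of_ne hne with hc | hc
    · obtain ⟨h1, h2⟩ := integrableOn_and_integral_hittingTerm_of_neg hs hs2 hc
      refine ⟨h1, ?_⟩
      rw [h2, abs_neg, Real.abs_exp,
        (integrableOn_and_integral_hittingTerm_of_pos hs hs2 (abs_pos.2 hne)).2, abs_of_neg hc]
      ring_nf
    · obtain ⟨h1, h2⟩ := integrableOn_and_integral_hittingTerm_of_pos hs hs2 hc
      refine ⟨h1, ?_⟩
      rw [abs_of_pos hc, h2, Real.abs_exp]
  have hswap := hasSum_integral_of_summable_integral_norm (fun k => (hterm k).1)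
    (by simpa only [(hterm _).2] using hsum.summable.abs)
  have heq := hswap.unique hsum
  rw [show b - a - (x0 - a) = b - x0 by ring] at heq
  rw [← heq]
  simp only [hittingTerm, tsum_mul_left]
end
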